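/- Under the same hypotheses (a)–(d) as in the approximate integration by parts theorem (ν a probability measure on M, f ∈ H¹(ν) with ∫ f² dν = 1 and ∫ Γ(f) dν ≤ Λ, weak eigenfunctions p₁,…,p_{k−1} ∈ H¹(ν) with positive eigenvalues λ₁,…,λ_{k−1}, pairwise L²(ν)-orthogonal, ∫ Γ(p_i,g) dν = λ_i ∫ p_i g dν for all g ∈ H¹(ν), ∫ (f − Σ p_j) p_i dν = 0 for all i, and λ ∫ g² dν ≤ ∫ Γ(g) dν for all g ∈ H¹(ν) with ∫ g p_i dν = 0 for all i), assuming in addition λ_i ≤ λ for every i, it holds for EVERY g ∈ H¹(ν) that | ∫ ( λ f g − Γ(f, g) ) dν | ≤ [ |Λ − λ|^{1/2} + Σ_{i=1}^{k−1} C_i ( ∫ p_i² dν )^{1/2} ] · ( ∫ Γ(g) dν )^{1/2}, where C_i = |λ − λ_i|^{1/2} + (λ − λ_i)/√λ_i. -/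

import Mathlib

open MeasureTheory Real

/-- Membership in `H¹(ν)`: `C¹`, centered, with integrable carré du champ
`Γ(f)(x) = a(x) f'(x)²`. -/
def MemH1 (a : ℝ → ℝ) (ν : MeasureTheory.Measure ℝ) (f : ℝ → ℝ) : Prop :=
  ContDiff ℝ 1 f ∧ (∫ x, f x ∂ν) = 0 ∧
    MeasureTheory.Integrable (fun x => a x * (deriv f x) ^ 2) ν

lemma sqrt_add_le_add_sqrt {x y : ℝ} (hx : 0 ≤ x) (hy : 0 ≤ y) : √(x + y) ≤ √x + √y := by
  rw [Real.sqrt_le_left (by positivity)]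
  nlinarith [Real.sq_sqrt hx, Real.sq_sqrt hy, mul_nonneg (Real.sqrt_nonneg x) (Real.sqrt_nonneg y)]

lemma sqrt_sum_le_sum_sqrt {ι : Type*} (s : Finset ι) (x : ι → ℝ) (hx : ∀ i, 0 ≤ x i) :
    √(∑ i ∈ s, x i) ≤ ∑ i ∈ s, √(x i) := by
  classical
  induction s using Finset.induction_on with
  | empty => simp
  | insert i s hi ih =>
    rw [Finset.sum_insert hi, Finset.sum_insert hi]
    exact (sqrt_add_le_add_sqrt (hx i) (Finset.sum_nonneg fun j _ => hx j)).trans (by gcongr)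

section WeakEigenvectors

variable {V ι : Type*} [AddCommGroup V] [Module ℝ V] [Fintype ι]

/-- Cauchy–Schwarz for a positive semidefinite symmetric form. -/
lemma sq_apply_le_of_symm (B : LinearMap.BilinForm ℝ V) (hB : ∀ u v, B u v = B v u)
    (hB0 : ∀ v, 0 ≤ B v v) (u v : V) : B u v ^ 2 ≤ B u u * B v v := by
  simpa only [sq, hB v u] using LinearMap.BilinForm.apply_mul_apply_le_of_forall_zero_le B hB0 u v

/-- Projection off a finite orthogonal family for a positive semidefinite form. -/
lemma exists_sub_sum_smul_orthogonal (I : LinearMap.BilinForm ℝ V) (hI : ∀ u v, I u v = I v u)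
    (hI0 : ∀ v, 0 ≤ I v v) (p : ι → V) (horth : ∀ i j, i ≠ j → I (p i) (p j) = 0) (v : V) :
    ∃ c : ι → ℝ, ∀ i, I (v - ∑ j, c j • p j) (p i) = 0 := by
  classical
  refine ⟨fun j => I v (p j) / I (p j) (p j), fun i => ?_⟩
  have hsum : I (∑ j, (I v (p j) / I (p j) (p j)) • p j) (p i)
      = I v (p i) / I (p i) (p i) * I (p i) (p i) := by
    rw [map_sum, LinearMap.sum_apply, Finset.sum_eq_single i]
    · simp
    · intro j _ hj
      simp [horth j i hj]
    · simp
  rw [map_sub, LinearMap.sub_apply, hsum]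
  rcases eq_or_ne (I (p i) (p i)) 0 with h | h
  · have := sq_apply_le_of_symm I hI hI0 v (p i)
    have h2 : I v (p i) = 0 := by
      rw [h, mul_zero] at this
      exact pow_eq_zero_iff two_ne_zero |>.1 (le_antisymm this (sq_nonneg _))
    simp [h2]
  · field_simp
    simp

/-- Pythagoras for the energy form along weak eigenvectors. -/
lemma apply_sum_smul_add_self (I E : LinearMap.BilinForm ℝ V) (hI : ∀ u v, I u v = I v u)
    (hE : ∀ u v, E u v = E v u)
    (p : ι → V) (l : ι → ℝ) (horth : ∀ i j, i ≠ j → I (p i) (p j) = 0)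
    (heig : ∀ i v, E (p i) v = l i * I (p i) v) (c : ι → ℝ) (r : V)
    (hr : ∀ i, I r (p i) = 0) :
    E (∑ j, c j • p j + r) (∑ j, c j • p j + r)
      = ∑ j, l j * (c j ^ 2 * I (p j) (p j)) + E r r := by
  classical
  have h1 : ∀ i, I (p i) (∑ j, c j • p j) = c i * I (p i) (p i) := by
    intro i
    rw [map_sum, Finset.sum_eq_single i]
    · simp
    · intro j _ hj
      simp [horth i j hj.symm]
    · simp
  have h2 : E (∑ j, c j • p j) r = 0 := by
    rw [map_sum, LinearMap.sum_apply]
    refine Finset.sum_eq_zero fun j _ => ?_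
    have : I (p j) r = 0 := by rw [← hr j]; exact hI _ _
    simp [heig, this]
  have h3 : E r (∑ j, c j • p j) = 0 := by rw [← h2]; exact hE _ _
  have h4 : E (∑ j, c j • p j) (∑ j, c j • p j) = ∑ j, l j * (c j ^ 2 * I (p j) (p j)) := by
    rw [LinearMap.map_sum₂]
    refine Finset.sum_congr rfl fun j _ => ?_
    rw [map_smul, LinearMap.smul_apply, heig, h1, smul_eq_mul]
    ring
  rw [LinearMap.map_add₂, map_add, map_add, h2, h3, h4]
  ring

/-- A spectral gap above positive eigenvalues yields a global Poincaré inequality. -/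
lemma exists_poincare_of_gap (I E : LinearMap.BilinForm ℝ V) (hI : ∀ u v, I u v = I v u)
    (hE : ∀ u v, E u v = E v u)
    (hI0 : ∀ v, 0 ≤ I v v) (hE0 : ∀ v, 0 ≤ E v v)
    (p : ι → V) (l : ι → ℝ) (hl : ∀ i, 0 < l i) (lam : ℝ) (hlam : 0 < lam)
    (horth : ∀ i j, i ≠ j → I (p i) (p j) = 0)
    (heig : ∀ i v, E (p i) v = l i * I (p i) v)
    (hgap : ∀ v, (∀ i, I v (p i) = 0) → lam * I v v ≤ E v v) :
    ∃ C, 0 ≤ C ∧ ∀ v, I v v ≤ C * E v v := by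
  refine ⟨1 / lam + ∑ i, 1 / l i, add_nonneg (by positivity)
    (Finset.sum_nonneg fun i _ => (one_div_pos.2 (hl i)).le), fun v => ?_⟩
  obtain ⟨c, hc⟩ := exists_sub_sum_smul_orthogonal I hI hI0 p horth v
  have hv : v = ∑ j, c j • p j + (v - ∑ j, c j • p j) := by abel
  set r := v - ∑ j, c j • p j
  have hEv := apply_sum_smul_add_self I E hI hE p l horth heig c r hc
  have hIv := apply_sum_smul_add_self I I hI hI p (fun _ => 1) horth (by simp) c r hc
  rw [← hv] at hEv hIv
  have hpos : ∀ j, 0 ≤ l j * (c j ^ 2 * I (p j) (p j)) := fun j =>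
    mul_nonneg (hl j).le (mul_nonneg (sq_nonneg _) (hI0 _))
  have hEr : E r r ≤ E v v := by
    rw [hEv]; linarith [Finset.sum_nonneg fun j (_ : j ∈ Finset.univ) => hpos j]
  have hEj : ∀ j, l j * (c j ^ 2 * I (p j) (p j)) ≤ E v v := by
    intro j
    rw [hEv]
    linarith [hE0 r, Finset.single_le_sum (fun i _ => hpos i) (Finset.mem_univ j)]
  have hIr : I r r ≤ 1 / lam * E v v := by
    rw [one_div, inv_mul_eq_div, le_div_iff₀ hlam]
    linarith [hgap r hc]
  rw [add_mul, Finset.sum_mul, hIv, add_comm]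
  refine add_le_add hIr (Finset.sum_le_sum fun j _ => ?_)
  rw [one_mul, one_div, inv_mul_eq_div, le_div_iff₀ (hl j)]
  linarith [hEj j]

/-- Approximate integration by parts for an abstract pair of forms: `I` is the inner product and
`E` the energy. -/
lemma abs_sub_le_of_weak_eigenvectors (I E : LinearMap.BilinForm ℝ V) (hI : ∀ u v, I u v = I v u)
    (hE : ∀ u v, E u v = E v u) (hI0 : ∀ v, 0 ≤ I v v) (hE0 : ∀ v, 0 ≤ E v v)
    (p : ι → V) (l : ι → ℝ) (hl : ∀ i, 0 < l i) (lam : ℝ) (hlam : 0 < lam)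
    (hle : ∀ i, l i ≤ lam)
    (horth : ∀ i j, i ≠ j → I (p i) (p j) = 0)
    (heig : ∀ i v, E (p i) v = l i * I (p i) v)
    (hgap : ∀ v, (∀ i, I v (p i) = 0) → lam * I v v ≤ E v v)
    (f : V) (Λ : ℝ) (hf1 : I f f = 1) (hfΛ : E f f ≤ Λ)
    (hq : ∀ i, I (f - ∑ j, p j) (p i) = 0) (g : V) :
    |lam * I f g - E f g|
      ≤ (√|Λ - lam| + ∑ i, (√|lam - l i| + (lam - l i) / √(l i)) * √(I (p i) (p i)))
        * √(E g g) := by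
  obtain ⟨c, hc⟩ := exists_sub_sum_smul_orthogonal I hI hI0 p horth g
  have hg : g = ∑ j, c j • p j + (g - ∑ j, c j • p j) := by abel
  set r := g - ∑ j, c j • p j
  have hf : f = ∑ j, (1 : ℝ) • p j + (f - ∑ j, p j) := by simp
  set q := f - ∑ j, p j
  have hEg := apply_sum_smul_add_self I E hI hE p l horth heig c r hc
  have hEf := apply_sum_smul_add_self I E hI hE p l horth heig (fun _ => 1) q hq
  have hIf := apply_sum_smul_add_self I I hI hI p (fun _ => 1) horth (by simp) (fun _ => 1) q hq
  rw [← hf] at hEf hIf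
  rw [← hg] at hEg
  have hpos : ∀ j, 0 ≤ l j * (c j ^ 2 * I (p j) (p j)) := fun j =>
    mul_nonneg (hl j).le (mul_nonneg (sq_nonneg _) (hI0 _))
  have hEr : E r r ≤ E g g := by
    rw [hEg]; linarith [Finset.sum_nonneg fun j (_ : j ∈ Finset.univ) => hpos j]
  -- Cauchy–Schwarz for the excess energy on the orthogonal complement
  let W : Submodule ℝ V :=
    { carrier := {v | ∀ i, I v (p i) = 0}
      add_mem' := fun {u v} hu hv i => by
        rw [map_add, LinearMap.add_apply, hu i, hv i, add_zero]
      zero_mem' := fun i => by simp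
      smul_mem' := fun t v hv i => by
        rw [map_smul, LinearMap.smul_apply, hv i, smul_zero] }
  let D : LinearMap.BilinForm ℝ V := E - lam • I
  have hD : ∀ u v, D u v = E u v - lam * I u v := fun u v => by simp [D]
  have hDsymm : ∀ u v, D u v = D v u := fun u v => by rw [hD, hD, hE, hI]
  have hCS : D q r ^ 2 ≤ D q q * D r r :=
    sq_apply_le_of_symm (D.restrict W) (fun u v => hDsymm u v)
      (fun u => by simpa [hD] using hgap u u.2) ⟨q, hq⟩ ⟨r, hc⟩
  have hDr0 : 0 ≤ D r r := by rw [hD]; linarith [hgap r hc]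
  have hDr : D r r ≤ E g g := by
    rw [hD]; linarith [mul_nonneg hlam.le (hI0 r)]
  have hgapi : ∀ i, |lam - l i| = lam - l i := fun i => abs_of_nonneg (by linarith [hle i])
  have hDq : D q q ≤ |Λ - lam| + ∑ i, |lam - l i| * I (p i) (p i) := by
    simp only [one_pow, one_mul] at hEf hIf
    simp_rw [hgapi, sub_mul, Finset.sum_sub_distrib, ← Finset.mul_sum]
    rw [hD]
    have h1 : lam * I q q = lam - lam * ∑ i, I (p i) (p i) := by
      rw [hf1] at hIf
      linear_combination (-lam) * hIf
    linarith [le_abs_self (Λ - lam)]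
  have hsqrtq : √(D q q) ≤ √|Λ - lam| + ∑ i, √|lam - l i| * √(I (p i) (p i)) := by
    refine (Real.sqrt_le_sqrt hDq).trans ((sqrt_add_le_add_sqrt (abs_nonneg _)
      (Finset.sum_nonneg fun i _ => mul_nonneg (abs_nonneg _) (hI0 _))).trans ?_)
    gcongr
    refine (sqrt_sum_le_sum_sqrt _ _ fun i => mul_nonneg (abs_nonneg _) (hI0 _)).trans_eq ?_
    exact Finset.sum_congr rfl fun i _ => Real.sqrt_mul (abs_nonneg _) _
  have hqr : |D q r| ≤ (√|Λ - lam| + ∑ i, √|lam - l i| * √(I (p i) (p i))) * √(E g g) := by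
    calc |D q r| = √(D q r ^ 2) := (Real.sqrt_sq_eq_abs _).symm
      _ ≤ √(D q q * D r r) := Real.sqrt_le_sqrt hCS
      _ = √(D q q) * √(D r r) := Real.sqrt_mul' _ hDr0
      _ ≤ _ := by gcongr
  have hDp : ∀ i v, D (p i) v = -((lam - l i) * I (p i) v) := fun i v => by
    rw [hD, heig]; ring
  have hqp : ∀ i, D q (p i) = 0 := fun i => by
    have h1 : E q (p i) = E (p i) q := hE _ _
    have h2 : I (p i) q = I q (p i) := hI _ _
    rw [hD, h1, heig, h2, hq i]; ring
  have hDfg : lam * I f g - E f g = ∑ i, (lam - l i) * I (p i) g + -D q r := by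
    have h1 : D f g = -(lam * I f g - E f g) := by rw [hD]; ring
    have h2 : D f g = ∑ i, D (p i) g + D q g := by
      conv_lhs => rw [hf]
      simp
    have h3 : D q g = D q r := by
      conv_lhs => rw [hg]
      simp [hqp]
    simp_rw [hDp, Finset.sum_neg_distrib] at h2
    linarith
  have hIpg : ∀ i, |I (p i) g| ≤ √(I (p i) (p i)) * (√(E g g) / √(l i)) := by
    intro i
    have h1 := sq_apply_le_of_symm E hE hE0 (p i) g
    rw [heig, heig] at h1
    have hli := hl i
    rw [← Real.sqrt_div' _ hli.le, ← Real.sqrt_mul (hI0 _)]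
    apply Real.abs_le_sqrt
    rw [mul_div_assoc', le_div_iff₀ hli]
    refine le_of_mul_le_mul_left ?_ hli
    nlinarith
  rw [hDfg]
  calc |∑ i, (lam - l i) * I (p i) g + -D q r|
      ≤ ∑ i, |(lam - l i) * I (p i) g| + |D q r| := by
        refine (abs_add_le _ _).trans ?_
        rw [abs_neg]
        gcongr
        exact Finset.abs_sum_le_sum_abs _ _
    _ ≤ ∑ i, (lam - l i) / √(l i) * √(I (p i) (p i)) * √(E g g)
        + (√|Λ - lam| + ∑ i, √|lam - l i| * √(I (p i) (p i))) * √(E g g) := by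
        refine add_le_add (Finset.sum_le_sum fun i _ => ?_) hqr
        rw [abs_mul, hgapi]
        refine (mul_le_mul_of_nonneg_left (hIpg i) (by linarith [hle i])).trans_eq ?_
        ring
    _ = _ := by
        rw [← Finset.sum_mul]
        simp_rw [add_mul, Finset.sum_add_distrib]
        ring

end WeakEigenvectors

section EnergyForm

variable {a : ℝ → ℝ} {ν : Measure ℝ}

/-- The carré du champ of two functions of finite energy is integrable. No measurability of `a` is
needed: `a` is determined by `a * (deriv u) ^ 2` wherever `deriv u` does not vanish. -/
lemma integrable_mul_deriv_mul_deriv (ha : ∀ x, 0 ≤ a x) {u v : ℝ → ℝ}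
    (hu' : Integrable (fun x => a x * deriv u x ^ 2) ν)
    (hv' : Integrable (fun x => a x * deriv v x ^ 2) ν) :
    Integrable (fun x => a x * deriv u x * deriv v x) ν := by
  have hmeas : AEStronglyMeasurable (fun x => a x * deriv u x * deriv v x) ν := by
    have h : AEMeasurable (fun x => a x * deriv u x ^ 2 * (deriv v x / deriv u x)) ν :=
      hu'.aemeasurable.mul ((measurable_deriv v).div (measurable_deriv u)).aemeasurable
    refine (h.congr (Filter.Eventually.of_forall fun x => ?_)).aestronglyMeasurable
    by_cases h0 : deriv u x = 0
    · simp [h0]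
    · field_simp
  refine (hu'.add hv').mono' hmeas (Filter.Eventually.of_forall fun x => ?_)
  rw [Real.norm_eq_abs, mul_assoc, abs_mul, abs_of_nonneg (ha x), Pi.add_apply, ← mul_add]
  refine mul_le_mul_of_nonneg_left (abs_le.2 ⟨?_, ?_⟩) (ha x)
  · nlinarith [sq_nonneg (deriv u x + deriv v x)]
  · nlinarith [sq_nonneg (deriv u x - deriv v x)]

/-- The square integrable elements of `H¹(ν)`. -/
def h1Submodule (a : ℝ → ℝ) (ν : Measure ℝ) [IsProbabilityMeasure ν] (ha : ∀ x, 0 ≤ a x) :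
    Submodule ℝ (ℝ → ℝ) where
  carrier := {u | MemH1 a ν u ∧ MemLp u 2 ν}
  add_mem' := by
    rintro u v ⟨⟨hu, hu0, hu'⟩, hu2⟩ ⟨⟨hv, hv0, hv'⟩, hv2⟩
    refine ⟨⟨hu.add hv, ?_, ?_⟩, hu2.add hv2⟩
    · simp [integral_add (hu2.integrable one_le_two) (hv2.integrable one_le_two), hu0, hv0]
    · have h : (fun x => a x * deriv (u + v) x ^ 2) = fun x => a x * deriv u x ^ 2
          + 2 * (a x * deriv u x * deriv v x) + a x * deriv v x ^ 2 := by
        funext x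
        rw [deriv_add (hu.differentiable one_ne_zero x) (hv.differentiable one_ne_zero x)]
        ring
      rw [h]
      exact (hu'.add ((integrable_mul_deriv_mul_deriv ha hu' hv').const_mul 2)).add hv'
  zero_mem' := ⟨⟨contDiff_const, by simp, by simp⟩, MemLp.zero⟩
  smul_mem' := by
    rintro c u ⟨⟨hu, hu0, hu'⟩, hu2⟩
    refine ⟨⟨contDiff_const.smul hu, ?_, ?_⟩, hu2.const_smul c⟩
    · simp [integral_const_mul, hu0]
    · have h : (fun x => a x * deriv (c • u) x ^ 2) = fun x => c ^ 2 * (a x * deriv u x ^ 2) := by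
        funext x
        rw [deriv_const_smul _ (hu.differentiable one_ne_zero x), smul_eq_mul]
        ring
      rw [h]
      exact hu'.const_mul _

variable [IsProbabilityMeasure ν]

lemma h1Submodule.integrable_mul {ha : ∀ x, 0 ≤ a x} (u v : h1Submodule a ν ha) :
    Integrable (fun x => (u : ℝ → ℝ) x * (v : ℝ → ℝ) x) ν :=
  u.2.2.integrable_mul v.2.2

lemma h1Submodule.integrable_energy {ha : ∀ x, 0 ≤ a x} (u v : h1Submodule a ν ha) :
    Integrable (fun x => a x * deriv (u : ℝ → ℝ) x * deriv (v : ℝ → ℝ) x) ν :=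
  integrable_mul_deriv_mul_deriv ha u.2.1.2.2 v.2.1.2.2

lemma h1Submodule.differentiableAt {ha : ∀ x, 0 ≤ a x} (u : h1Submodule a ν ha) (x : ℝ) :
    DifferentiableAt ℝ (u : ℝ → ℝ) x :=
  u.2.1.1.differentiable one_ne_zero x

/-- The `L²(ν)` inner product. -/
noncomputable def innerForm (a : ℝ → ℝ) (ν : Measure ℝ) [IsProbabilityMeasure ν]
    (ha : ∀ x, 0 ≤ a x) : LinearMap.BilinForm ℝ (h1Submodule a ν ha) :=
  LinearMap.mk₂ ℝ (fun u v => ∫ x, (u : ℝ → ℝ) x * (v : ℝ → ℝ) x ∂ν)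
    (fun u v w => by
      rw [← integral_add (h1Submodule.integrable_mul u w) (h1Submodule.integrable_mul v w)]
      simp [add_mul])
    (fun c u v => by simp [mul_assoc, integral_const_mul])
    (fun u v w => by
      rw [← integral_add (h1Submodule.integrable_mul u v) (h1Submodule.integrable_mul u w)]
      simp [mul_add])
    (fun c u v => by simp [mul_left_comm, integral_const_mul])

/-- The energy form `∫ Γ(u, v) dν`. -/
noncomputable def energyForm (a : ℝ → ℝ) (ν : Measure ℝ) [IsProbabilityMeasure ν]
    (ha : ∀ x, 0 ≤ a x) : LinearMap.BilinForm ℝ (h1Submodule a ν ha) :=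
  LinearMap.mk₂ ℝ (fun u v => ∫ x, a x * deriv (u : ℝ → ℝ) x * deriv (v : ℝ → ℝ) x ∂ν)
    (fun u v w => by
      rw [← integral_add (h1Submodule.integrable_energy u w) (h1Submodule.integrable_energy v w)]
      refine integral_congr_ae (Filter.Eventually.of_forall fun x => ?_)
      simp only [Submodule.coe_add]
      rw [deriv_add (h1Submodule.differentiableAt u x) (h1Submodule.differentiableAt v x)]
      ring)
    (fun c u v => by
      rw [smul_eq_mul, ← integral_const_mul]
      refine integral_congr_ae (Filter.Eventually.of_forall fun x => ?_)
      simp only [Submodule.coe_smul]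
      rw [deriv_const_smul _ (h1Submodule.differentiableAt u x), smul_eq_mul]
      ring)
    (fun u v w => by
      rw [← integral_add (h1Submodule.integrable_energy u v) (h1Submodule.integrable_energy u w)]
      refine integral_congr_ae (Filter.Eventually.of_forall fun x => ?_)
      simp only [Submodule.coe_add]
      rw [deriv_add (h1Submodule.differentiableAt v x) (h1Submodule.differentiableAt w x)]
      ring)
    (fun c u v => by
      rw [smul_eq_mul, ← integral_const_mul]
      refine integral_congr_ae (Filter.Eventually.of_forall fun x => ?_)
      simp only [Submodule.coe_smul]
      rw [deriv_const_smul _ (h1Submodule.differentiableAt v x), smul_eq_mul]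
      ring)

lemma innerForm_apply (ha : ∀ x, 0 ≤ a x) (u v : h1Submodule a ν ha) :
    innerForm a ν ha u v = ∫ x, (u : ℝ → ℝ) x * (v : ℝ → ℝ) x ∂ν := rfl

lemma energyForm_apply (ha : ∀ x, 0 ≤ a x) (u v : h1Submodule a ν ha) :
    energyForm a ν ha u v = ∫ x, a x * deriv (u : ℝ → ℝ) x * deriv (v : ℝ → ℝ) x ∂ν := rfl

lemma innerForm_self (ha : ∀ x, 0 ≤ a x) (u : h1Submodule a ν ha) :
    innerForm a ν ha u u = ∫ x, (u : ℝ → ℝ) x ^ 2 ∂ν := by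
  simp only [innerForm_apply, sq]

lemma energyForm_self (ha : ∀ x, 0 ≤ a x) (u : h1Submodule a ν ha) :
    energyForm a ν ha u u = ∫ x, a x * deriv (u : ℝ → ℝ) x ^ 2 ∂ν := by
  simp only [energyForm_apply, sq, mul_assoc]

lemma innerForm_comm (ha : ∀ x, 0 ≤ a x) (u v : h1Submodule a ν ha) :
    innerForm a ν ha u v = innerForm a ν ha v u := by
  simp only [innerForm_apply, mul_comm]

lemma energyForm_comm (ha : ∀ x, 0 ≤ a x) (u v : h1Submodule a ν ha) :
    energyForm a ν ha u v = energyForm a ν ha v u := by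
  simp only [energyForm_apply, mul_right_comm]

lemma innerForm_self_nonneg (ha : ∀ x, 0 ≤ a x) (u : h1Submodule a ν ha) :
    0 ≤ innerForm a ν ha u u := by
  rw [innerForm_self]
  exact integral_nonneg fun x => sq_nonneg _

lemma energyForm_self_nonneg (ha : ∀ x, 0 ≤ a x) (u : h1Submodule a ν ha) :
    0 ≤ energyForm a ν ha u u := by
  rw [energyForm_self]
  exact integral_nonneg fun x => mul_nonneg (ha x) (sq_nonneg _)

end EnergyForm

section Truncation

variable {a : ℝ → ℝ} {ν : Measure ℝ} [IsProbabilityMeasure ν]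

/-- Bounded `C¹` functions with bounded derivative. -/
structure IsTruncation (χ : ℝ → ℝ) : Prop where
  contDiff : ContDiff ℝ 1 χ
  bounded : ∃ C, ∀ x, |χ x| ≤ C
  deriv_bounded : ∃ K, ∀ x, |deriv χ x| ≤ K

lemma isTruncation_const (c : ℝ) : IsTruncation fun _ => c :=
  ⟨contDiff_const, ⟨|c|, fun _ => le_rfl⟩, ⟨0, by simp⟩⟩

lemma IsTruncation.const_mul {χ : ℝ → ℝ} (h : IsTruncation χ) (c : ℝ) :
    IsTruncation fun x => c * χ x := by
  obtain ⟨h1, ⟨C, hC⟩, ⟨K, hK⟩⟩ := h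
  refine ⟨contDiff_const.mul h1, ⟨|c| * C, fun x => ?_⟩, ⟨|c| * K, fun x => ?_⟩⟩
  · rw [abs_mul]
    gcongr
    exact hC x
  · rw [deriv_const_mul _ (h1.differentiable one_ne_zero x), abs_mul]
    gcongr
    exact hK x

lemma IsTruncation.sub {χ ξ : ℝ → ℝ} (h : IsTruncation χ) (h' : IsTruncation ξ) :
    IsTruncation fun x => χ x - ξ x := by
  obtain ⟨h1, ⟨C, hC⟩, ⟨K, hK⟩⟩ := h
  obtain ⟨h1', ⟨C', hC'⟩, ⟨K', hK'⟩⟩ := h'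
  refine ⟨h1.sub h1', ⟨C + C', fun x => ?_⟩, ⟨K + K', fun x => ?_⟩⟩
  · exact (abs_sub _ _).trans (add_le_add (hC x) (hC' x))
  · rw [deriv_fun_sub (h1.differentiable one_ne_zero x) (h1'.differentiable one_ne_zero x)]
    exact (abs_sub _ _).trans (add_le_add (hK x) (hK' x))

lemma hasDerivAt_div_one_add_mul_sq {ε : ℝ} (hε : 0 ≤ ε) (c x : ℝ) :
    HasDerivAt (fun x => (x - c) / (1 + ε * (x - c) ^ 2))
      ((1 - ε * (x - c) ^ 2) / (1 + ε * (x - c) ^ 2) ^ 2) x := by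
  have hne : 1 + ε * (x - c) ^ 2 ≠ 0 := by positivity
  have h1 : HasDerivAt (fun x => x - c) 1 x := (hasDerivAt_id x).sub_const c
  have h2 : HasDerivAt (fun x => (x - c) ^ 2) (2 * (x - c)) x := by
    simpa using h1.fun_pow 2
  convert! h1.fun_div ((h2.const_mul ε).const_add 1) hne using 1
  congr 1
  ring

lemma abs_deriv_div_one_add_mul_sq_le {ε : ℝ} (hε : 0 ≤ ε) (c x : ℝ) :
    |deriv (fun x => (x - c) / (1 + ε * (x - c) ^ 2)) x| ≤ 1 := by
  rw [(hasDerivAt_div_one_add_mul_sq hε c x).deriv, abs_div, abs_pow _ 2,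
    abs_of_pos (show 0 < 1 + ε * (x - c) ^ 2 by positivity),
    div_le_one (by positivity), abs_le]
  have : 0 ≤ ε * (x - c) ^ 2 := by positivity
  constructor <;> nlinarith

/-- A rational approximation of the identity by bounded functions. -/
lemma isTruncation_div_one_add_mul_sq {ε : ℝ} (hε : 0 < ε) (c : ℝ) :
    IsTruncation fun x => (x - c) / (1 + ε * (x - c) ^ 2) := by
  refine ⟨?_, ⟨1 + 1 / ε, fun x => ?_⟩, ⟨1, abs_deriv_div_one_add_mul_sq_le hε.le c⟩⟩
  · exact (contDiff_id.sub contDiff_const).div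
      (contDiff_const.add (contDiff_const.mul ((contDiff_id.sub contDiff_const).pow 2)))
      fun x => by positivity
  · rw [abs_div, abs_of_pos (show 0 < 1 + ε * (x - c) ^ 2 by positivity),
      div_le_iff₀ (by positivity)]
    have h : (1 + 1 / ε) * (1 + ε * (x - c) ^ 2)
        = 1 + 1 / ε + ε * (x - c) ^ 2 + (x - c) ^ 2 := by
      field_simp
      ring
    rw [h, ← sq_abs (x - c)]
    have : 0 < 1 / ε := by positivity
    nlinarith [sq_nonneg (|x - c| - 1), mul_nonneg hε.le (sq_nonneg |x - c|)]

lemma isTruncation_one_div_one_add_sq : IsTruncation fun x => 1 / (1 + x ^ 2) := by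
  refine ⟨?_, ⟨1, fun x => ?_⟩, ⟨1, fun x => ?_⟩⟩
  · exact contDiff_const.div (contDiff_const.add (contDiff_id.pow 2)) fun x => by positivity
  · rw [abs_of_nonneg (by positivity), div_le_one (by positivity)]
    nlinarith [sq_nonneg x]
  · have h : HasDerivAt (fun x : ℝ => 1 / (1 + x ^ 2)) (-(2 * x) / (1 + x ^ 2) ^ 2) x := by
      convert! (hasDerivAt_const x (1 : ℝ)).div ((hasDerivAt_pow 2 x).const_add 1)
        (show 1 + x ^ 2 ≠ 0 by positivity) using 1
      simp
    rw [h.deriv, abs_div, abs_pow _ 2, abs_of_pos (show 0 < 1 + x ^ 2 by positivity),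
      div_le_one (by positivity), abs_le]
    constructor <;> nlinarith [sq_nonneg (x - 1), sq_nonneg (x + 1), sq_nonneg (x ^ 2)]

lemma IsTruncation.integrable_comp {χ : ℝ → ℝ} (h : IsTruncation χ) {u : ℝ → ℝ}
    (hu : Continuous u) : Integrable (fun x => χ (u x)) ν := by
  obtain ⟨C, hC⟩ := h.bounded
  exact Integrable.of_bound (h.contDiff.continuous.comp hu).aestronglyMeasurable C
    (Filter.Eventually.of_forall fun x => hC _)

lemma IsTruncation.deriv_comp {χ : ℝ → ℝ} (h : IsTruncation χ) {u : ℝ → ℝ}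
    (hu : ContDiff ℝ 1 u) (x : ℝ) :
    deriv (fun x => χ (u x)) x = deriv χ (u x) * deriv u x :=
  ((h.contDiff.differentiable one_ne_zero (u x)).hasDerivAt.comp x
    (hu.differentiable one_ne_zero x).hasDerivAt).deriv

/-- Centered truncations of elements of `H¹(ν)` are square integrable elements of `H¹(ν)`. -/
lemma IsTruncation.comp_mem (ha : ∀ x, 0 ≤ a x) {χ : ℝ → ℝ} (h : IsTruncation χ) {u : ℝ → ℝ}
    (hu : MemH1 a ν u) (h0 : ∫ x, χ (u x) ∂ν = 0) :
    (fun x => χ (u x)) ∈ h1Submodule a ν ha := by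
  obtain ⟨hu1, -, hu'⟩ := hu
  obtain ⟨C, hC⟩ := h.bounded
  obtain ⟨K, hK⟩ := h.deriv_bounded
  have hcont : Continuous fun x => χ (u x) := h.contDiff.continuous.comp hu1.continuous
  refine ⟨⟨h.contDiff.comp hu1, h0, ?_⟩, MemLp.of_bound hcont.aestronglyMeasurable C
    (Filter.Eventually.of_forall fun x => hC _)⟩
  have hd : Continuous (deriv χ) := h.contDiff.continuous_deriv le_rfl
  refine (hu'.bdd_mul (f := fun x => deriv χ (u x) ^ 2) (c := K ^ 2)
    ((hd.comp hu1.continuous).pow 2).aestronglyMeasurable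
    (Filter.Eventually.of_forall fun x => ?_)).congr (Filter.Eventually.of_forall fun x => ?_)
  · rw [Real.norm_eq_abs, abs_pow]
    exact pow_le_pow_left₀ (abs_nonneg _) (hK _) 2
  · dsimp only
    rw [h.deriv_comp hu1]
    ring

end Truncation

section SquareIntegrability

variable {a : ℝ → ℝ} {ν : Measure ℝ} [IsProbabilityMeasure ν]

lemma integral_one_div_one_add_sq_pos {u : ℝ → ℝ} (hu : Continuous u) :
    0 < ∫ x, 1 / (1 + u x ^ 2) ∂ν := by
  rw [integral_pos_iff_support_of_nonneg (fun x => by positivity)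
    (isTruncation_one_div_one_add_sq.integrable_comp hu)]
  have : (Function.support fun x => 1 / (1 + u x ^ 2)) = Set.univ :=
    Function.support_eq_univ fun x => by positivity
  rw [this]
  simp

/-- Weak eigenfunctions with nonzero eigenvalue are square integrable, even when the integrals in
the eigenvalue equation are only required to agree with their default values. -/
lemma memLp_two_of_weak_eigenfunction (ha : ∀ x, 0 ≤ a x) {u : ℝ → ℝ} (hu : MemH1 a ν u)
    {l : ℝ} (hl : l ≠ 0)
    (heig : ∀ g, MemH1 a ν g → ∫ x, a x * deriv u x * deriv g x ∂ν = l * ∫ x, u x * g x ∂ν) :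
    MemLp u 2 ν := by
  have hcont : Continuous u := hu.1.continuous
  rw [memLp_two_iff_integrable_sq hcont.aestronglyMeasurable]
  by_contra hnot
  -- otherwise `u` has zero energy
  have hE : ∫ x, a x * deriv u x ^ 2 ∂ν = 0 := by
    have h := heig u hu
    simp_rw [mul_assoc, ← sq] at h
    rw [h, integral_undef hnot, mul_zero]
  have hE' : ∀ᵐ x ∂ν, a x * deriv u x ^ 2 = 0 :=
    (integral_eq_zero_iff_of_nonneg (fun x => mul_nonneg (ha x) (sq_nonneg _)) hu.2.2).1 hE
  have key : ∀ χ, IsTruncation χ → ∫ x, χ (u x) ∂ν = 0 → ∫ x, u x * χ (u x) ∂ν = 0 := by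
    intro χ hχ h0
    have h := heig _ (hχ.comp_mem ha hu h0).1
    have h1 : ∫ x, a x * deriv u x * deriv (fun x => χ (u x)) x ∂ν = 0 := by
      refine integral_eq_zero_of_ae (hE'.mono fun x hx => ?_)
      rw [Pi.zero_apply]
      dsimp only
      rw [hχ.deriv_comp hu.1]
      linear_combination deriv χ (u x) * hx
    exact (mul_eq_zero.1 (h.symm.trans h1)).resolve_left hl
  -- hence `u` is a.e. equal to the following weighted mean
  set A := ∫ x, 1 / (1 + u x ^ 2) ∂ν
  have hA : 0 < A := integral_one_div_one_add_sq_pos hcont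
  set c := (∫ x, u x / (1 + u x ^ 2) ∂ν) / A with hc
  set ψ : ℝ → ℝ := fun y => (y - c) / (1 + 1 * (y - c) ^ 2) with hψ_def
  have hψ : IsTruncation ψ := isTruncation_div_one_add_mul_sq one_pos c
  set B := ∫ x, ψ (u x) ∂ν
  have hφ := isTruncation_one_div_one_add_sq
  have hφi := hφ.integrable_comp (ν := ν) hcont
  have hψi := hψ.integrable_comp (ν := ν) hcont
  have hχ := (hψ.const_mul A).sub (hφ.const_mul B)
  have h0 := key _ hχ (by
    rw [integral_sub (hψi.const_mul A) (hφi.const_mul B), integral_const_mul, integral_const_mul]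
    ring)
  have huφ : Integrable (fun x => u x / (1 + u x ^ 2)) ν := by
    simpa using (isTruncation_div_one_add_mul_sq one_pos 0).integrable_comp (ν := ν) hcont
  have hden : ∀ y, 1 + 1 * (y - c) ^ 2 ≠ 0 := fun y => by positivity
  have hsq : Integrable (fun x => (u x - c) * ψ (u x)) ν := by
    have hψc := hψ.contDiff.continuous
    refine Integrable.of_bound (C := 1)
      ((hcont.sub continuous_const).mul (hψc.comp hcont)).aestronglyMeasurable
      (Filter.Eventually.of_forall fun x => ?_)
    have h2 : (u x - c) * ψ (u x) = (u x - c) ^ 2 / (1 + 1 * (u x - c) ^ 2) := by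
      simp only [hψ_def]; ring
    rw [h2, Real.norm_of_nonneg (by positivity), div_le_one (by positivity)]
    linarith
  have hint : ∫ x, (u x - c) * ψ (u x) ∂ν = 0 := by
    have hsplit : (fun x => u x * (A * ψ (u x) - B * (1 / (1 + u x ^ 2))))
        = fun x => A * ((u x - c) * ψ (u x)) + A * c * ψ (u x) - B * (u x / (1 + u x ^ 2)) := by
      funext x
      ring
    have hcA : ∫ x, u x / (1 + u x ^ 2) ∂ν = c * A := by
      rw [hc, div_mul_cancel₀ _ hA.ne']
    rw [hsplit, integral_sub (by exact (hsq.const_mul A).add (hψi.const_mul (A * c)))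
      (huφ.const_mul B),
      integral_add (hsq.const_mul A) (hψi.const_mul (A * c)), integral_const_mul,
      integral_const_mul, integral_const_mul, hcA] at h0
    have : A * ∫ x, (u x - c) * ψ (u x) ∂ν = 0 := by linear_combination h0
    exact (mul_eq_zero.1 this).resolve_left hA.ne'
  have hnn : ∀ y, 0 ≤ (y - c) * ψ y := fun y => by
    have : (y - c) * ψ y = (y - c) ^ 2 / (1 + 1 * (y - c) ^ 2) := by
      simp only [hψ_def]; ring
    rw [this]
    positivity
  have hconst : ∀ᵐ x ∂ν, u x = c := by
    refine ((integral_eq_zero_iff_of_nonneg (fun x => hnn (u x)) hsq).1 hint).mono fun x hx => ?_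
    have h2 : (u x - c) * ((u x - c) / (1 + 1 * (u x - c) ^ 2)) = 0 := hx
    rw [← mul_div_assoc, div_eq_zero_iff, or_iff_left (hden _), mul_self_eq_zero] at h2
    linarith
  exact hnot ((integrable_const (c ^ 2)).congr (hconst.mono fun x hx => by simp [hx]))

/-- If a Poincaré inequality holds for the square integrable elements of `H¹(ν)`, then all of
`H¹(ν)` is square integrable. -/
lemma memLp_two_of_poincare (ha : ∀ x, 0 ≤ a x) {C : ℝ} (hC : 0 ≤ C)
    (hpoinc : ∀ v, innerForm a ν ha v v ≤ C * energyForm a ν ha v v)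
    {g : ℝ → ℝ} (hg : MemH1 a ν g) : MemLp g 2 ν := by
  have hcont : Continuous g := hg.1.continuous
  rw [memLp_two_iff_integrable_sq hcont.aestronglyMeasurable]
  let ε : ℕ → ℝ := fun n => 1 / ((n : ℝ) + 1)
  have hε : ∀ n, 0 < ε n := fun n => by positivity
  let T : ℕ → ℝ → ℝ := fun n y => (y - 0) / (1 + ε n * (y - 0) ^ 2)
  have hT : ∀ n, IsTruncation (T n) := fun n => isTruncation_div_one_add_mul_sq (hε n) 0
  have hTi : ∀ n, Integrable (fun x => T n (g x)) ν := fun n => (hT n).integrable_comp hcont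
  have hTabs : ∀ n y, |T n y| ≤ |y| := fun n y => by
    have h1 : 0 ≤ ε n * (y - 0) ^ 2 := mul_nonneg (hε n).le (sq_nonneg _)
    simp only [T]
    rw [abs_div, abs_of_pos (show 0 < 1 + ε n * (y - 0) ^ 2 by linarith), sub_zero]
    rw [sub_zero] at h1
    exact div_le_self (abs_nonneg _) (by linarith)
  let m : ℕ → ℝ := fun n => ∫ x, T n (g x) ∂ν
  have hχ : ∀ n, IsTruncation fun y => T n y - m n := fun n => (hT n).sub (isTruncation_const _)
  have hmem : ∀ n, (fun x => T n (g x) - m n) ∈ h1Submodule a ν ha := fun n =>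
    (hχ n).comp_mem ha hg (by
      rw [integral_sub (hTi n) (integrable_const _)]
      simp [m])
  have hsqi : ∀ n, Integrable (fun x => (T n (g x) - m n) ^ 2) ν := fun n =>
    (hmem n).2.integrable_sq
  set K := C * ∫ x, a x * deriv g x ^ 2 ∂ν
  have hK : ∀ n, ∫ x, (T n (g x) - m n) ^ 2 ∂ν ≤ K := by
    intro n
    have h := hpoinc ⟨_, hmem n⟩
    rw [innerForm_self, energyForm_self] at h
    refine h.trans (mul_le_mul_of_nonneg_left ?_ hC)
    refine integral_mono (hmem n).1.2.2 hg.2.2 fun x => mul_le_mul_of_nonneg_left ?_ (ha x)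
    change deriv (fun x => T n (g x) - m n) x ^ 2 ≤ _
    rw [(hχ n).deriv_comp hg.1, mul_pow, deriv_sub_const]
    refine mul_le_of_le_one_left (sq_nonneg _) ?_
    rw [sq_le_one_iff_abs_le_one]
    exact abs_deriv_div_one_add_mul_sq_le (hε n).le 0 _
  -- the means of the truncations stay bounded
  set W := ∫ x, 1 / (1 + g x ^ 2) ∂ν
  have hW : 0 < W := integral_one_div_one_add_sq_pos hcont
  have hm : ∀ n, |m n| ≤ (K + 2) / W := by
    intro n
    rw [le_div_iff₀ hW, ← integral_const_mul]
    calc ∫ x, |m n| * (1 / (1 + g x ^ 2)) ∂ν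
        ≤ ∫ x, ((T n (g x) - m n) ^ 2 + 2) ∂ν := by
          refine integral_mono
            ((isTruncation_one_div_one_add_sq.integrable_comp hcont).const_mul _)
            ((hsqi n).add (integrable_const _)) fun x => ?_
          have h1 : |m n| ≤ |T n (g x) - m n| + |g x| := by
            have := abs_sub_abs_le_abs_sub (m n) (T n (g x))
            rw [abs_sub_comm] at this
            linarith [hTabs n (g x)]
          dsimp only
          rw [mul_one_div, div_le_iff₀ (by positivity), ← sq_abs (g x),
            ← sq_abs (T n (g x) - m n)]
          nlinarith [sq_nonneg (|T n (g x) - m n| - 1), sq_nonneg (|g x| - 1),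
            sq_nonneg (|T n (g x) - m n| * |g x|)]
      _ ≤ K + 2 := by
          rw [integral_add (hsqi n) (integrable_const _)]
          simpa using hK n
  have hbound : ∀ n, ∫ x, T n (g x) ^ 2 ∂ν ≤ 2 * K + 2 * ((K + 2) / W) ^ 2 := by
    intro n
    calc ∫ x, T n (g x) ^ 2 ∂ν ≤ ∫ x, (2 * (T n (g x) - m n) ^ 2 + 2 * m n ^ 2) ∂ν := by
          refine integral_mono_of_nonneg (Filter.Eventually.of_forall fun x => sq_nonneg _)
            (((hsqi n).const_mul 2).add (integrable_const _))
            (Filter.Eventually.of_forall fun x => ?_)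
          dsimp only
          nlinarith [sq_nonneg (T n (g x) - 2 * m n)]
      _ = 2 * ∫ x, (T n (g x) - m n) ^ 2 ∂ν + 2 * m n ^ 2 := by
          rw [integral_add ((hsqi n).const_mul 2) (integrable_const _), integral_const_mul]
          simp
      _ ≤ _ := by
          have h2 : m n ^ 2 ≤ ((K + 2) / W) ^ 2 := by
            rw [← sq_abs]
            exact pow_le_pow_left₀ (abs_nonneg _) (hm n) 2
          linarith [hK n]
  have hTcont : ∀ n, Continuous fun x => T n (g x) ^ 2 := fun n =>
    ((hT n).contDiff.continuous.comp hcont).pow 2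
  have hTsqi : ∀ n, Integrable (fun x => T n (g x) ^ 2) ν := fun n => by
    obtain ⟨D, hD⟩ := (hT n).bounded
    refine Integrable.of_bound (hTcont n).aestronglyMeasurable (D ^ 2)
      (Filter.Eventually.of_forall fun x => ?_)
    rw [Real.norm_eq_abs, abs_pow]
    exact pow_le_pow_left₀ (abs_nonneg _) (hD _) 2
  refine integrable_of_tendsto (G := fun n x => T n (g x) ^ 2)
    (Filter.Eventually.of_forall fun x => ?_) (fun n => (hTcont n).aestronglyMeasurable) ?_
  · have h1 : Filter.Tendsto ε Filter.atTop (nhds 0) := tendsto_one_div_add_atTop_nhds_zero_nat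
    have h2 := ((tendsto_const_nhds (x := g x - 0)).div
      ((h1.mul_const ((g x - 0) ^ 2)).const_add 1) (by simp)).pow 2
    simpa [T] using h2
  · refine ne_top_of_le_ne_top
      (ENNReal.ofReal_ne_top (r := 2 * K + 2 * ((K + 2) / W) ^ 2))
      (Filter.liminf_le_of_le (by isBoundedDefault) fun b hb => ?_)
    obtain ⟨n, hn⟩ := hb.exists
    refine hn.trans ?_
    rw [← ofReal_integral_norm_eq_lintegral_enorm (hTsqi n)]
    refine ENNReal.ofReal_le_ofReal ?_
    simpa using hbound n

end SquareIntegrability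

/-- Approximate integration by parts formula extended to all of `H¹(ν)`
(Corollary 3.3). -/
theorem approx_ibp_extended
    (ν : Measure ℝ) [IsProbabilityMeasure ν]
    (a : ℝ → ℝ) (ha : ∀ x, 0 ≤ a x)
    (k : ℕ) (hk : 1 ≤ k)
    (f : ℝ → ℝ) (hf : MemH1 a ν f)
    (Λ : ℝ) (hf2 : ∫ x, (f x) ^ 2 ∂ν = 1)
    (hfΓ : ∫ x, a x * (deriv f x) ^ 2 ∂ν ≤ Λ)
    (p : Fin (k - 1) → ℝ → ℝ) (hp : ∀ i, MemH1 a ν (p i))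
    (lams : Fin (k - 1) → ℝ) (hlams : ∀ i, 0 < lams i)
    (lam : ℝ) (hlam : 0 < lam)
    (hle : ∀ i, lams i ≤ lam)
    (horth : ∀ i j, i ≠ j → ∫ x, p i x * p j x ∂ν = 0)
    (heig : ∀ i, ∀ g, MemH1 a ν g →
      ∫ x, a x * deriv (p i) x * deriv g x ∂ν = lams i * ∫ x, p i x * g x ∂ν)
    (hperp : ∀ i, ∫ x, (f x - ∑ j, p j x) * p i x ∂ν = 0)
    (hpoinc : ∀ g, MemH1 a ν g → (∀ i, ∫ x, g x * p i x ∂ν = 0) →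
      lam * ∫ x, (g x) ^ 2 ∂ν ≤ ∫ x, a x * (deriv g x) ^ 2 ∂ν) :
    ∀ g, MemH1 a ν g →
      |∫ x, (lam * f x * g x - a x * deriv f x * deriv g x) ∂ν|
        ≤ (Real.sqrt |Λ - lam|
            + ∑ i, (Real.sqrt |lam - lams i| + (lam - lams i) / Real.sqrt (lams i))
                * Real.sqrt (∫ x, (p i x) ^ 2 ∂ν))
          * Real.sqrt (∫ x, a x * (deriv g x) ^ 2 ∂ν) := by
  intro g hg
  have hp2 : ∀ i, MemLp (p i) 2 ν := fun i =>
    memLp_two_of_weak_eigenfunction ha (hp i) (hlams i).ne' (heig i)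
  have hf2' : MemLp f 2 ν := by
    rw [memLp_two_iff_integrable_sq hf.1.continuous.aestronglyMeasurable]
    exact Integrable.of_integral_ne_zero (by rw [hf2]; exact one_ne_zero)
  let P : Fin (k - 1) → h1Submodule a ν ha := fun i => ⟨p i, hp i, hp2 i⟩
  have horth' : ∀ i j, i ≠ j → innerForm a ν ha (P i) (P j) = 0 := horth
  have heig' : ∀ i v, energyForm a ν ha (P i) v = lams i * innerForm a ν ha (P i) v :=
    fun i v => heig i v v.2.1
  have hgap : ∀ v, (∀ i, innerForm a ν ha v (P i) = 0) →
      lam * innerForm a ν ha v v ≤ energyForm a ν ha v v := fun v hv => by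
    rw [innerForm_self, energyForm_self]
    exact hpoinc v v.2.1 hv
  obtain ⟨C, hC, hpoincare⟩ := exists_poincare_of_gap _ _ (innerForm_comm ha) (energyForm_comm ha)
    (innerForm_self_nonneg ha) (energyForm_self_nonneg ha) P lams hlams lam hlam horth' heig' hgap
  let F : h1Submodule a ν ha := ⟨f, hf, hf2'⟩
  let G : h1Submodule a ν ha := ⟨g, hg, memLp_two_of_poincare ha hC hpoincare hg⟩
  have h := abs_sub_le_of_weak_eigenvectors _ _ (innerForm_comm ha) (energyForm_comm ha)
    (innerForm_self_nonneg ha) (energyForm_self_nonneg ha) P lams hlams lam hlam hle horth' heig'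
    hgap F Λ (by rw [innerForm_self]; exact hf2) (by rw [energyForm_self]; exact hfΓ)
    (fun i => by
      rw [innerForm_apply, ← hperp i]
      simp [F, P]) G
  simp only [innerForm_self, energyForm_self] at h
  have hLHS : ∫ x, (lam * f x * g x - a x * deriv f x * deriv g x) ∂ν
      = lam * innerForm a ν ha F G - energyForm a ν ha F G := by
    rw [innerForm_apply, energyForm_apply, ← integral_const_mul,
      ← integral_sub ((h1Submodule.integrable_mul F G).const_mul lam)
        (h1Submodule.integrable_energy F G)]
    simp only [F, G, mul_assoc]
  rw [hLHS]
  exact h
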